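/- For every nonzero λ ∈ k^c, the left A-module Au_λ is indecomposable. -/

import Mathlib

open scoped TensorProduct

/-- The relations defining the quantum complete intersection `A^c_q`:
`x_i ^ a = 0` for all `i`, and `x_i x_j = q • x_j x_i` for `i < j`. -/
inductive QCIRel (k : Type) [Field k] (c a : ℕ) (q : k) :
    FreeAlgebra k (Fin c) → FreeAlgebra k (Fin c) → Prop
  | pow (i : Fin c) : QCIRel k c a q (FreeAlgebra.ι k i ^ a) 0
  | comm (i j : Fin c) (hij : i < j) :
      QCIRel k c a q (FreeAlgebra.ι k i * FreeAlgebra.ι k j)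
        (q • (FreeAlgebra.ι k j * FreeAlgebra.ι k i))

/-- The quantum complete intersection algebra `A^c_q = k⟨x_1,…,x_c⟩/(x_i^a, x_ix_j - q x_jx_i)`. -/
def QCI (k : Type) [Field k] (c a : ℕ) (q : k) : Type := RingQuot (QCIRel k c a q)

noncomputable instance (k : Type) [Field k] (c a : ℕ) (q : k) : Ring (QCI k c a q) :=
  inferInstanceAs (Ring (RingQuot (QCIRel k c a q)))

noncomputable instance (k : Type) [Field k] (c a : ℕ) (q : k) : Algebra k (QCI k c a q) :=
  inferInstanceAs (Algebra k (RingQuot (QCIRel k c a q)))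

namespace QCI

variable (k : Type) [Field k] (c a : ℕ) (q : k)

/-- The generators `x_i` of the quantum complete intersection. -/
noncomputable def x (i : Fin c) : QCI k c a q :=
  RingQuot.mkAlgHom k (QCIRel k c a q) (FreeAlgebra.ι k i)

/-- The element `u_λ = λ_1 x_1 + ⋯ + λ_c x_c` of `A^c_q`. -/
noncomputable def u (lam : Fin c → k) : QCI k c a q :=
  ∑ i, lam i • QCI.x k c a q i

end QCI

/-- `a' = a / gcd(a, char k)` if `char k > 0`, and `a' = a` if `char k = 0`. -/
noncomputable def aprime (k : Type) [Field k] (a : ℕ) : ℕ :=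
  if ringChar k > 0 then a / Nat.gcd a (ringChar k) else a

/-- A nilpotent submodule `V` of an algebra is contained in a nilpotent submodule that is closed
under multiplication. -/
theorem Submodule.exists_isNilpotent_mul_self_le {R A : Type*} [CommSemiring R] [Semiring A]
    [Algebra R A] {V : Submodule R A} (hV : IsNilpotent V) :
    ∃ W : Submodule R A, IsNilpotent W ∧ V ≤ W ∧ W * W ≤ W := by
  obtain ⟨n, hn⟩ := hV
  have hle : ∀ m, V ^ (m + 1) ≤ ∑ i ∈ Finset.range (n + 1), V ^ (i + 1) := fun m ↦ by
    by_cases hm : m < n + 1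
    · exact Finset.single_le_sum_of_canonicallyOrdered (f := fun i ↦ V ^ (i + 1))
        (Finset.mem_range.2 hm)
    · rw [pow_eq_zero_of_le (by omega) hn]
      exact bot_le
  refine ⟨∑ i ∈ Finset.range (n + 1), V ^ (i + 1), ?_, ?_, ?_⟩
  · exact Commute.isNilpotent_sum (fun i _ ↦ IsNilpotent.pow_of_pos ⟨n, hn⟩ i.succ_ne_zero)
      fun i j _ _ ↦ Commute.pow_pow_self V _ _
  · simpa using hle 0
  · rw [Finset.sum_mul_sum]
    refine Finset.sum_induction _ (· ≤ ∑ i ∈ Finset.range (n + 1), V ^ (i + 1))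
      (fun _ _ ↦ add_le) bot_le fun i _ ↦ Finset.sum_induction _
      (· ≤ ∑ i ∈ Finset.range (n + 1), V ^ (i + 1)) (fun _ _ ↦ add_le) bot_le fun j _ ↦ ?_
    rw [← pow_add]
    exact hle (i + 1 + j)

/-- A cyclic module over a ring in which `r` or `1 - r` is a unit for every `r` cannot be written
as an internal direct sum of two nonzero submodules. -/
theorem Submodule.eq_bot_or_eq_bot_of_isCompl_of_span_singleton {R M : Type*} [Ring R]
    [AddCommGroup M] [Module R M] (hR : ∀ r : R, IsUnit r ∨ IsUnit (1 - r)) (v : M)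
    {P Q : Submodule R (Submodule.span R {v})} (h : IsCompl P Q) : P = ⊥ ∨ Q = ⊥ := by
  let w : Submodule.span R {v} := ⟨v, Submodule.mem_span_singleton_self v⟩
  have htop : ∀ N : Submodule R (Submodule.span R {v}), w ∈ N → N = ⊤ := by
    rintro N hN
    rw [eq_top_iff]
    rintro ⟨y, hy⟩ -
    obtain ⟨r, rfl⟩ := Submodule.mem_span_singleton.1 hy
    exact N.smul_mem r hN
  have hunit : ∀ (N : Submodule R (Submodule.span R {v})) (r : R), IsUnit r → r • w ∈ N →
      N = ⊤ := fun N r hr hN ↦ by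
    obtain ⟨s, rfl⟩ := hr
    refine htop N ?_
    simpa [smul_smul] using N.smul_mem (↑s⁻¹ : R) hN
  obtain ⟨p, hp, s, hs, hps⟩ := Submodule.mem_sup.1
    (h.sup_eq_top ▸ Submodule.mem_top : w ∈ P ⊔ Q)
  obtain ⟨r, hr⟩ := Submodule.mem_span_singleton.1 p.2
  have hrp : r • w = p := Subtype.ext hr
  rcases hR r with hu | hu
  · right
    have := hunit P r hu (hrp ▸ hp)
    subst this
    simpa using h.inf_eq_bot
  · left
    have := hunit Q (1 - r) hu (by
      rwa [sub_smul, one_smul, hrp, ← hps, add_sub_cancel_left])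
    subst this
    simpa using h.inf_eq_bot

theorem aprime_ne_zero (k : Type) [Field k] {a : ℕ} (ha : a ≠ 0) : aprime k a ≠ 0 := by
  unfold aprime
  split_ifs
  · exact (Nat.div_pos (Nat.gcd_le_left _ (Nat.pos_of_ne_zero ha))
      (Nat.gcd_pos_of_pos_left _ (Nat.pos_of_ne_zero ha))).ne'
  · exact ha

namespace QCI

variable (k : Type) [Field k] (c a : ℕ) (q : k)

theorem x_pow (i : Fin c) : x k c a q i ^ a = 0 := by
  have h := RingQuot.mkAlgHom_rel k (QCIRel.pow (k := k) (q := q) (a := a) i)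
  rw [map_pow, map_zero] at h
  exact h

theorem x_mul_x {i j : Fin c} (hij : i < j) :
    x k c a q i * x k c a q j = q • (x k c a q j * x k c a q i) := by
  have h := RingQuot.mkAlgHom_rel k (QCIRel.comm (k := k) (q := q) (a := a) i j hij)
  rw [map_mul, map_smul, map_mul] at h
  exact h

theorem commute_span_x {q : k} (hq : q ≠ 0) (i j : Fin c) :
    Commute (Submodule.span k {x k c a q i}) (Submodule.span k {x k c a q j}) := by
  have key : ∀ {i j : Fin c}, i < j →
      Commute (Submodule.span k {x k c a q i}) (Submodule.span k {x k c a q j}) := fun hij ↦ by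
    rw [Commute, SemiconjBy, Submodule.span_mul_span, Submodule.span_mul_span,
      Set.singleton_mul_singleton, Set.singleton_mul_singleton, x_mul_x k c a q hij]
    exact Submodule.span_singleton_smul_eq hq.isUnit _
  rcases lt_trichotomy i j with h | rfl | h
  · exact key h
  · exact Commute.refl _
  · exact (key h).symm

theorem isNilpotent_sum_span_x {q : k} (hq : q ≠ 0) :
    IsNilpotent (∑ i, Submodule.span k {x k c a q i}) :=
  Commute.isNilpotent_sum
    (fun i _ ↦ ⟨a, by
      rw [Submodule.span_pow, Set.singleton_pow, x_pow, Submodule.span_zero_singleton,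
        Submodule.zero_eq_bot]⟩)
    fun i j _ _ ↦ commute_span_x k c a hq i j

theorem exists_eq_algebraMap_add_isNilpotent {q : k} (hq : q ≠ 0) (r : QCI k c a q) :
    ∃ (t : k) (m : QCI k c a q), IsNilpotent m ∧ r = algebraMap k _ t + m := by
  obtain ⟨W, ⟨n, hn⟩, hVW, hWW⟩ :=
    Submodule.exists_isNilpotent_mul_self_le (isNilpotent_sum_span_x k c a hq)
  suffices ∃ (t : k), ∃ m ∈ W, r = algebraMap k _ t + m by
    obtain ⟨t, m, hm, h⟩ := this
    refine ⟨t, m, ⟨n, ?_⟩, h⟩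
    simpa [hn] using Submodule.pow_mem_pow W hm n
  obtain ⟨f, rfl⟩ := RingQuot.mkAlgHom_surjective k (QCIRel k c a q) r
  change ∃ (t : k), ∃ m ∈ W, (RingQuot.mkAlgHom k (QCIRel k c a q) f : QCI k c a q) = _
  induction f with
  | grade0 t => exact ⟨t, 0, W.zero_mem, by rw [add_zero]; exact AlgHom.commutes _ t⟩
  | grade1 i =>
    refine ⟨0, x k c a q i, hVW ?_, by rw [map_zero, zero_add]; rfl⟩
    exact Finset.single_le_sum_of_canonicallyOrdered
      (f := fun i ↦ Submodule.span k {x k c a q i}) (Finset.mem_univ i)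
      (Submodule.mem_span_singleton_self _)
  | mul f g hf hg =>
    obtain ⟨s, m, hm, hf⟩ := hf
    obtain ⟨t, m', hm', hg⟩ := hg
    refine ⟨s * t, s • m' + t • m + m * m', W.add_mem (W.add_mem (W.smul_mem _ hm')
      (W.smul_mem _ hm)) (hWW (Submodule.mul_mem_mul hm hm')), ?_⟩
    refine (map_mul _ f g).trans ((congrArg₂ (· * ·) hf hg).trans ?_)
    change (algebraMap k _ s + m) * (algebraMap k _ t + m') = (_ : QCI k c a q)
    rw [add_mul, mul_add, mul_add, ← map_mul, ← Algebra.smul_def, ← Algebra.commutes t m,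
      ← Algebra.smul_def]
    abel
  | add f g hf hg =>
    obtain ⟨s, m, hm, hf⟩ := hf
    obtain ⟨t, m', hm', hg⟩ := hg
    refine ⟨s + t, m + m', W.add_mem hm hm', ?_⟩
    refine (map_add _ f g).trans ((congrArg₂ (· + ·) hf hg).trans ?_)
    change (algebraMap k _ s + m) + (algebraMap k _ t + m') = (_ : QCI k c a q)
    rw [map_add]
    abel

theorem isUnit_or_isUnit_one_sub {q : k} (hq : q ≠ 0) (r : QCI k c a q) :
    IsUnit r ∨ IsUnit (1 - r) := by
  obtain ⟨t, m, hm, rfl⟩ := exists_eq_algebraMap_add_isNilpotent k c a hq r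
  by_cases ht : t = 0
  · right
    simpa [ht] using hm.isUnit_one_sub
  · left
    exact hm.isUnit_add_left_of_commute ((Ne.isUnit ht).map (algebraMap k _))
      (Algebra.commutes t m).symm

theorem u_ne_zero (ha : 2 ≤ a) {lam : Fin c → k} (hlam : lam ≠ 0) : u k c a q lam ≠ 0 := by
  let f : QCI k c a q →ₐ[k] TrivSqZeroExt k (Fin c → k) :=
    RingQuot.liftAlgHom k ⟨FreeAlgebra.lift k fun i ↦ TrivSqZeroExt.inr (Pi.single i 1), by
      rintro _ _ (⟨i⟩ | ⟨i, j, hij⟩)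
      · rw [map_pow, map_zero, FreeAlgebra.lift_ι_apply]
        exact pow_eq_zero_of_le ha (by rw [pow_two, TrivSqZeroExt.inr_mul_inr])
      · simp⟩
  have hf : ∀ i, f (x k c a q i) = TrivSqZeroExt.inr (Pi.single i 1) := fun i ↦
    (RingQuot.liftAlgHom_mkAlgHom_apply k _ _ _).trans (FreeAlgebra.lift_ι_apply _ _)
  intro h
  apply hlam
  have hu : (f (u k c a q lam)).snd = 0 := by rw [h, map_zero, TrivSqZeroExt.snd_zero]
  ext i
  simpa [u, hf, TrivSqZeroExt.snd_sum, Finset.sum_apply, Pi.single_apply] using congrFun hu i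

end QCI

/-- For every nonzero `λ ∈ k^c`, the left `A`-module `Au_λ` is indecomposable: it is nonzero,
and whenever it is the internal direct sum of two submodules, one of them is zero. -/
theorem span_uLam_indecomposable (k : Type) [Field k] [IsAlgClosed k] (a c : ℕ)
    (ha : 2 ≤ a) (hc : 1 ≤ c) (q : k) (hq : IsPrimitiveRoot q (aprime k a))
    (lam : Fin c → k) (hlam : lam ≠ 0) :
    Submodule.span (QCI k c a q) {QCI.u k c a q lam} ≠ ⊥ ∧
    ∀ P Q : Submodule (QCI k c a q)
        (Submodule.span (QCI k c a q) {QCI.u k c a q lam}),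
      IsCompl P Q → P = ⊥ ∨ Q = ⊥ := by
  refine ⟨fun h ↦ QCI.u_ne_zero k c a q ha hlam (Submodule.span_singleton_eq_bot.1 h),
    fun P Q h ↦ Submodule.eq_bot_or_eq_bot_of_isCompl_of_span_singleton
      (QCI.isUnit_or_isUnit_one_sub k c a (hq.ne_zero ?_)) _ h⟩
  exact aprime_ne_zero k (by omega)
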